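/- Fix δ > 0 and integers n, k with 5 ≤ k, k ≤ n^{1/2−δ}, and n^{2δ} ≥ 2; let m = C(n,k). Let ℓ be an integer with 1 ≤ ℓ ≤ k, let S be a k-element subset of {1,…,n}, and let A be a family of k-element subsets of {1,…,n} with |A| ≥ 4(m−1)/n^{2ℓδ}. Then (1/|A|) Σ_{S_i ∈ A} ⟨D̂_S, D̂_{S_i}⟩_U < 2^{ℓ+2} k²/n², where U is the uniform distribution on {0,1}^n. -/

import Mathlib

/-- The planted k-biclique distribution D_S on {0,1}^n. -/
noncomputable def bicliqueD (n k : ℕ) (S : Finset (Fin n)) (x : Fin n → Bool) : ℝ :=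
  if ∀ i ∈ S, x i = true
  then (1 - (k:ℝ)/n) / 2 ^ n + ((k:ℝ)/n) / 2 ^ (n - k)
  else (1 - (k:ℝ)/n) / 2 ^ n

/-- The inner product ⟨D̂_S, D̂_T⟩_U of the "hat" functions of two planted biclique
distributions relative to the uniform distribution U on {0,1}^n. -/
noncomputable def bicliqueCorr (n k : ℕ) (S T : Finset (Fin n)) : ℝ :=
  ∑ x : Fin n → Bool,
    ((1:ℝ) / 2 ^ n) *
      ((bicliqueD n k S x / ((1:ℝ) / 2 ^ n) - 1) *
        (bicliqueD n k T x / ((1:ℝ) / 2 ^ n) - 1))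

theorem Fintype.card_filter_forall_mem_eq_true {ι : Type*} [Fintype ι] [DecidableEq ι]
    (U : Finset ι) [DecidablePred fun x : ι → Bool => ∀ i ∈ U, x i = true] :
    (Finset.univ.filter fun x : ι → Bool => ∀ i ∈ U, x i = true).card
      = 2 ^ (Fintype.card ι - U.card) := by
  have h : (Finset.univ.filter fun x : ι → Bool => ∀ i ∈ U, x i = true)
      = Fintype.piFinset fun i => if i ∈ U then {true} else Finset.univ := by
    ext x
    simp only [Finset.mem_filter, Finset.mem_univ, true_and, Fintype.mem_piFinset]
    refine forall_congr' fun i => ?_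
    split_ifs with hi <;> simp [hi]
  rw [h, Fintype.card_piFinset]
  simp only [apply_ite Finset.card, Finset.card_singleton, Finset.card_univ, Fintype.card_bool]
  rw [Finset.prod_ite, Finset.prod_const_one, one_mul, Finset.prod_const,
    ← Finset.card_compl]
  congr 2
  ext i
  simp

theorem bicliqueD_div_uniform_sub_one {n k : ℕ} (hkn : k ≤ n) (S : Finset (Fin n))
    (x : Fin n → Bool) :
    bicliqueD n k S x / ((1:ℝ) / 2 ^ n) - 1
      = (k:ℝ) / n * (2 ^ k * (if ∀ i ∈ S, x i = true then 1 else 0) - 1) := by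
  have h : (2:ℝ) ^ n = 2 ^ (n - k) * 2 ^ k := by rw [← pow_add, Nat.sub_add_cancel hkn]
  unfold bicliqueD
  split_ifs
  · rw [h]
    field_simp
    ring
  · field_simp
    ring

theorem bicliqueCorr_eq {n k : ℕ} (hkn : k ≤ n) {S T : Finset (Fin n)}
    (hS : S.card = k) (hT : T.card = k) :
    bicliqueCorr n k S T = ((k:ℝ) / n) ^ 2 * (2 ^ (S ∩ T).card - 1) := by
  have hsum (U : Finset (Fin n)) :
      ∑ x : Fin n → Bool, (if ∀ i ∈ U, x i = true then (1:ℝ) else 0) = 2 ^ n / 2 ^ U.card := by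
    have hU : U.card ≤ n := by simpa using U.card_le_univ
    rw [Finset.sum_boole, Fintype.card_filter_forall_mem_eq_true, Fintype.card_fin,
      eq_div_iff (by positivity)]
    push_cast
    rw [← pow_add, Nat.sub_add_cancel hU]
  have hterm (x : Fin n → Bool) :
      ((1:ℝ) / 2 ^ n) * ((bicliqueD n k S x / ((1:ℝ) / 2 ^ n) - 1) *
        (bicliqueD n k T x / ((1:ℝ) / 2 ^ n) - 1))
      = ((k:ℝ) / n) ^ 2 / 2 ^ n *
        ((2 ^ k) ^ 2 * (if ∀ i ∈ S ∪ T, x i = true then 1 else 0)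
          - 2 ^ k * (if ∀ i ∈ S, x i = true then 1 else 0)
          - 2 ^ k * (if ∀ i ∈ T, x i = true then 1 else 0) + 1) := by
    rw [bicliqueD_div_uniform_sub_one hkn, bicliqueD_div_uniform_sub_one hkn]
    simp only [Finset.forall_mem_union]
    split_ifs <;> first | ring1 | tauto
  have hcard : (2:ℝ) ^ (S ∪ T).card * 2 ^ (S ∩ T).card = (2 ^ k) ^ 2 := by
    rw [← pow_add, Finset.card_union_add_card_inter, hS, hT, pow_add, sq]
  unfold bicliqueCorr
  simp_rw [hterm]
  rw [← Finset.mul_sum, Finset.sum_add_distrib, Finset.sum_sub_distrib, Finset.sum_sub_distrib,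
    ← Finset.mul_sum, ← Finset.mul_sum, ← Finset.mul_sum, hsum, hsum, hsum, hS, hT, ← hcard]
  simp only [Finset.sum_const, Finset.card_univ, Fintype.card_fun, Fintype.card_fin,
    Fintype.card_bool, nsmul_eq_mul, Nat.cast_pow, Nat.cast_ofNat]
  field_simp
  ring

theorem Nat.choose_sub_sub_mul_pow_le {n k r : ℕ} (hrk : r ≤ k) (hkn : k ≤ n) :
    (n - r).choose (k - r) * n ^ r ≤ n.choose k * k ^ r := by
  induction r with
  | zero => simp
  | succ r ih =>
    obtain ⟨b, rfl⟩ := Nat.exists_eq_add_of_le hrk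
    obtain ⟨c, rfl⟩ := Nat.exists_eq_add_of_le hkn
    have ih := ih (by omega)
    rw [show r + 1 + b + c - r = b + c + 1 by omega, show r + 1 + b - r = b + 1 by omega] at ih
    rw [show r + 1 + b + c - (r + 1) = b + c by omega, show r + 1 + b - (r + 1) = b by omega]
    have hc : (b + c).choose b * (r + 1 + b + c) ≤ (b + c + 1).choose (b + 1) * (r + 1 + b) := by
      have h := Nat.add_one_mul_choose_eq (b + c) b
      have hle : (b + c).choose b ≤ (b + c + 1).choose (b + 1) := by
        rw [Nat.choose_succ_succ]
        exact Nat.le_add_right _ _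
      nlinarith
    calc (b + c).choose b * (r + 1 + b + c) ^ (r + 1)
        = ((b + c).choose b * (r + 1 + b + c)) * (r + 1 + b + c) ^ r := by ring
      _ ≤ ((b + c + 1).choose (b + 1) * (r + 1 + b)) * (r + 1 + b + c) ^ r := by gcongr
      _ = ((b + c + 1).choose (b + 1) * (r + 1 + b + c) ^ r) * (r + 1 + b) := by ring
      _ ≤ ((r + 1 + b + c).choose (r + 1 + b) * (r + 1 + b) ^ r) * (r + 1 + b) := by gcongr
      _ = _ := by ring

theorem Finset.card_filter_subset_powersetCard_le {α : Type*} [Fintype α] [DecidableEq α]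
    (R : Finset α) (k : ℕ) :
    ((Finset.powersetCard k (Finset.univ : Finset α)).filter (R ⊆ ·)).card
      ≤ (Fintype.card α - R.card).choose (k - R.card) := by
  rw [← Finset.card_compl, ← Finset.card_powersetCard]
  refine Finset.card_le_card_of_injOn (· \ R) ?_ ?_
  · intro T hT
    simp only [Finset.coe_filter, Finset.mem_powersetCard, Set.mem_ofPred_eq] at hT
    simp only [Finset.mem_coe, Finset.mem_powersetCard]
    refine ⟨fun i hi => by simpa using (Finset.mem_sdiff.1 hi).2, ?_⟩
    rw [Finset.card_sdiff_of_subset hT.2, hT.1.2]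
  · intro T hT T' hT' h
    simp only [Finset.coe_filter, Set.mem_ofPred_eq] at hT hT'
    rw [← Finset.sdiff_union_of_subset hT.2, ← Finset.sdiff_union_of_subset hT'.2]
    exact congrArg (· ∪ R) h

/-- The exponential moment of the intersection of a fixed `k`-set with a uniform `k`-set. -/
theorem sum_pow_card_inter_le {n k : ℕ} (hkn : k ≤ n) (hn : 0 < n) {S : Finset (Fin n)}
    (hS : S.card = k) {t : ℝ} (ht : 0 ≤ t) :
    ∑ T ∈ Finset.powersetCard k (Finset.univ : Finset (Fin n)), (t + 1) ^ (S ∩ T).card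
      ≤ n.choose k * (t * (k / n) + 1) ^ k := by
  have hexp (T : Finset (Fin n)) :
      (t + 1) ^ (S ∩ T).card = ∑ R ∈ S.powerset, if R ⊆ T then t ^ R.card else 0 := by
    rw [← Finset.sum_filter, ← Finset.sum_pow_mul_eq_add_pow]
    simp only [one_pow, mul_one]
    refine Finset.sum_congr ?_ fun _ _ => rfl
    ext R
    rw [Finset.mem_powerset, Finset.subset_inter_iff, Finset.mem_filter, Finset.mem_powerset]
  have hcount (R : Finset (Fin n)) (hR : R.card ≤ k) :
      (((Finset.powersetCard k (Finset.univ : Finset (Fin n))).filter (R ⊆ ·)).card : ℝ)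
        ≤ n.choose k * ((k:ℝ) / n) ^ R.card := by
    rw [div_pow, ← mul_div_assoc, le_div_iff₀ (by positivity)]
    have h := Finset.card_filter_subset_powersetCard_le R k
    rw [Fintype.card_fin] at h
    exact_mod_cast (Nat.mul_le_mul_right _ h).trans (Nat.choose_sub_sub_mul_pow_le hR hkn)
  simp_rw [hexp]
  rw [Finset.sum_comm]
  calc ∑ R ∈ S.powerset, ∑ T ∈ Finset.powersetCard k (Finset.univ : Finset (Fin n)),
        (if R ⊆ T then t ^ R.card else 0)
      ≤ ∑ R ∈ S.powerset, (n.choose k : ℝ) * (t * (k / n)) ^ R.card := by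
        refine Finset.sum_le_sum fun R hR => ?_
        rw [← Finset.sum_filter, Finset.sum_const, nsmul_eq_mul, mul_pow]
        have h := hcount R (hS ▸ Finset.card_le_card (Finset.mem_powerset.1 hR))
        calc _ ≤ n.choose k * ((k:ℝ) / n) ^ R.card * t ^ R.card := by gcongr
          _ = _ := by ring
    _ = n.choose k * (t * (k / n) + 1) ^ k := by
        rw [← Finset.mul_sum, ← hS, ← Finset.sum_pow_mul_eq_add_pow]
        simp

theorem two_pow_le_two_pow_mul_one_add {D : ℝ} (hD : 2 ≤ D) (ℓ j : ℕ) :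
    (2:ℝ) ^ j ≤ 2 ^ ℓ * (1 + (D + 1) ^ j / D ^ ℓ) := by
  have hD0 : 0 < D := by linarith
  rcases le_total j ℓ with h | h
  · have h1 : (2:ℝ) ^ j ≤ 2 ^ ℓ := pow_le_pow_right₀ (by norm_num) h
    have h2 : (0:ℝ) ≤ (D + 1) ^ j / D ^ ℓ := by positivity
    nlinarith [pow_pos (two_pos : (0:ℝ) < 2) ℓ]
  · obtain ⟨i, rfl⟩ := Nat.exists_eq_add_of_le h
    rw [pow_add]
    gcongr
    calc (2:ℝ) ^ i ≤ D ^ i := by gcongr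
      _ = D ^ (ℓ + i) / D ^ ℓ := by rw [pow_add]; field_simp
      _ ≤ (D + 1) ^ (ℓ + i) / D ^ ℓ := by gcongr; linarith
      _ ≤ _ := by linarith

/-- Lemma 5.2: any sufficiently large family A of planted biclique distributions has
small average correlation with a fixed planted biclique distribution D_S. -/
theorem stmt_13 (δ : ℝ) (hδ : 0 < δ) (n k : ℕ) (hk : 5 ≤ k)
    (hkn : (k:ℝ) ≤ (n:ℝ) ^ ((1:ℝ)/2 - δ)) (hn2 : (2:ℝ) ≤ (n:ℝ) ^ (2 * δ))
    (ℓ : ℕ) (hℓ1 : 1 ≤ ℓ) (hℓk : ℓ ≤ k)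
    (S : Finset (Fin n)) (hS : S.card = k)
    (A : Finset (Finset (Fin n))) (hAk : ∀ S' ∈ A, S'.card = k)
    (hAsize : 4 * ((Nat.choose n k : ℝ) - 1) / (n:ℝ) ^ (2 * (ℓ:ℝ) * δ) ≤ (A.card : ℝ)) :
    (1 / (A.card : ℝ)) * ∑ Si ∈ A, bicliqueCorr n k S Si
      < 2 ^ (ℓ + 2) * (k:ℝ) ^ 2 / (n:ℝ) ^ 2 := by
  have hn : 0 < n := by
    rcases Nat.eq_zero_or_pos n with rfl | h
    · rw [Nat.cast_zero, Real.zero_rpow (by positivity)] at hn2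
      norm_num at hn2
    · exact h
  have hnR : (0:ℝ) < n := by exact_mod_cast hn
  have hkR : (5:ℝ) ≤ k := by exact_mod_cast hk
  have hD : (n:ℝ) ^ (2 * (ℓ:ℝ) * δ) = ((n:ℝ) ^ (2 * δ)) ^ ℓ := by
    rw [← Real.rpow_natCast, ← Real.rpow_mul hnR.le]
    ring_nf
  have hkD : (k:ℝ) ^ 2 * (n:ℝ) ^ (2 * δ) ≤ n := by
    calc (k:ℝ) ^ 2 * (n:ℝ) ^ (2 * δ)
        ≤ ((n:ℝ) ^ ((1:ℝ) / 2 - δ)) ^ 2 * (n:ℝ) ^ (2 * δ) := by gcongr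
      _ = (n:ℝ) := by
        rw [← Real.rpow_natCast, ← Real.rpow_mul hnR.le, ← Real.rpow_add hnR,
          show ((1:ℝ) / 2 - δ) * (2:ℕ) + 2 * δ = 1 by push_cast; ring, Real.rpow_one]
  rw [hD] at hAsize
  set D : ℝ := (n:ℝ) ^ (2 * δ)
  have hD0 : 0 < D := by linarith
  have hlt : k < n := by
    have : (k:ℝ) < n := by nlinarith
    exact_mod_cast this
  have hm : (2:ℝ) ≤ n.choose k := by
    have h1 : n.choose k ≠ 1 := by
      rw [Ne, Nat.choose_eq_one_iff]
      omega
    have h2 := Nat.choose_pos hlt.le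
    have h3 : 2 ≤ n.choose k := by omega
    exact_mod_cast h3
  have hA0 : (0:ℝ) < A.card := lt_of_lt_of_le (div_pos (by linarith) (by positivity)) hAsize
  have hmoment : ∑ T ∈ A, (D + 1) ^ (S ∩ T).card ≤ 3 * (n.choose k : ℝ) := by
    calc ∑ T ∈ A, (D + 1) ^ (S ∩ T).card
        ≤ ∑ T ∈ Finset.powersetCard k (Finset.univ : Finset (Fin n)),
            (D + 1) ^ (S ∩ T).card := by
          refine Finset.sum_le_sum_of_subset_of_nonneg (fun T hT => ?_) fun _ _ _ => by positivity
          simpa using hAk T hT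
      _ ≤ n.choose k * (D * (k / n) + 1) ^ k := sum_pow_card_inter_le hlt.le hn hS hD0.le
      _ ≤ n.choose k * Real.exp 1 := by
          gcongr
          calc (D * (k / n) + 1) ^ k ≤ Real.exp (D * (k / n)) ^ k := by
                gcongr
                exact Real.add_one_le_exp _
            _ = Real.exp (k * (D * (k / n))) := (Real.exp_nat_mul _ _).symm
            _ ≤ Real.exp 1 := by
                gcongr
                rw [show (k:ℝ) * (D * (k / n)) = k ^ 2 * D / n by ring]
                exact (div_le_one hnR).2 hkD
      _ ≤ 3 * n.choose k := by nlinarith [Real.exp_one_lt_three]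
  have hsum : ∑ T ∈ A, ((2:ℝ) ^ (S ∩ T).card - 1) < 2 ^ (ℓ + 2) * A.card := by
    have h1 : ∑ T ∈ A, ((2:ℝ) ^ (S ∩ T).card - 1)
        ≤ 2 ^ ℓ * (A.card + (∑ T ∈ A, (D + 1) ^ (S ∩ T).card) / D ^ ℓ) := by
      rw [Finset.sum_div, Finset.cast_card, ← Finset.sum_add_distrib, Finset.mul_sum]
      refine Finset.sum_le_sum fun T _ => ?_
      linarith [two_pow_le_two_pow_mul_one_add hn2 ℓ (S ∩ T).card]
    have h2 : (∑ T ∈ A, (D + 1) ^ (S ∩ T).card) / D ^ ℓ < 3 * A.card := by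
      rw [div_le_iff₀ (by positivity)] at hAsize
      rw [div_lt_iff₀ (by positivity)]
      linarith
    calc _ ≤ _ := h1
      _ < 2 ^ ℓ * (A.card + 3 * A.card) := by gcongr
      _ = _ := by ring
  rw [Finset.sum_congr rfl fun T hT => bicliqueCorr_eq hlt.le hS (hAk T hT), ← Finset.mul_sum]
  have hkn0 : 0 < ((k:ℝ) / n) ^ 2 := by positivity
  calc 1 / (A.card : ℝ) * (((k:ℝ) / n) ^ 2 * ∑ T ∈ A, ((2:ℝ) ^ (S ∩ T).card - 1))
      < 1 / (A.card : ℝ) * (((k:ℝ) / n) ^ 2 * (2 ^ (ℓ + 2) * A.card)) := by gcongr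
    _ = 2 ^ (ℓ + 2) * (k:ℝ) ^ 2 / (n:ℝ) ^ 2 := by field_simp
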